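/- arXiv:2411.17147 — 3 statements merged into one kernel-verified Lean document; each statement's English description precedes it below -/
import Mathlib

section
/- Let s, μ, ν > 0 and set ε₀ = min{s, μ, 2ν}/2. There exists a constant C = C(s, μ, ν) with the following property. Let A ∈ [0,∞), let (α_N)_{N ∈ 2^ℕ} be nonnegative extended reals indexed by the dyadic integers, and let (β_K^N)_{K,N ∈ 2^ℕ} be nonnegative extended reals such that: (i) β_K^N ≤ A·(K/N)^{2s}·α_N for all dyadic K, N; and (ii) β_K^N ≤ A·(N/K)^{2μ} · Σ_{L ∈ 2^ℕ, L ≤ N} (L/N)^{2ν} α_L whenever 4N ≤ K. Then for every dyadic K: ( Σ_{N ∈ 2^ℕ} √(β_K^N) )² ≤ C·A· Σ_{N ∈ 2^ℕ} max(N/K, K/N)^{−ε₀} · α_N, with all sums taken in [0,∞]. -/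
open scoped ENNReal

lemma ENNReal.two_pow_div_two_pow (m n : ℕ) :
    (2 : ℝ≥0∞) ^ m / (2 : ℝ≥0∞) ^ n = (2 : ℝ≥0∞) ^ ((m : ℝ) - n) := by
  rw [ENNReal.rpow_sub _ _ two_ne_zero ENNReal.ofNat_ne_top, ENNReal.rpow_natCast,
    ENNReal.rpow_natCast]

lemma ENNReal.max_two_pow_div_two_pow (m n : ℕ) :
    max ((2 : ℝ≥0∞) ^ m / (2 : ℝ≥0∞) ^ n) ((2 : ℝ≥0∞) ^ n / (2 : ℝ≥0∞) ^ m) =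
      (2 : ℝ≥0∞) ^ |(m : ℝ) - n| := by
  have mono : Monotone fun x : ℝ => (2 : ℝ≥0∞) ^ x := fun x y h =>
    ENNReal.rpow_le_rpow_of_exponent_le one_le_two h
  rw [two_pow_div_two_pow, two_pow_div_two_pow, ← mono.map_max, abs_eq_max_neg, neg_sub]

lemma ENNReal.tsum_int_two_rpow_neg_mul_abs_ne_top {δ : ℝ} (hδ : 0 < δ) :
    ∑' z : ℤ, (2 : ℝ≥0∞) ^ (-δ * |(z : ℝ)|) ≠ ∞ := by
  have hr : (2 : ℝ≥0∞) ^ (-δ) < 1 :=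
    ENNReal.rpow_lt_one_of_one_lt_of_neg one_lt_two (neg_lt_zero.mpr hδ)
  have hgeom : ∑' n : ℕ, ((2 : ℝ≥0∞) ^ (-δ)) ^ n ≠ ∞ := by
    rw [ENNReal.tsum_geometric]
    exact ENNReal.inv_ne_top.mpr (tsub_pos_of_lt hr).ne'
  rw [tsum_of_nat_of_neg_add_one ENNReal.summable ENNReal.summable]
  refine ENNReal.add_ne_top.mpr ⟨ne_top_of_le_ne_top hgeom ?_, ne_top_of_le_ne_top hgeom ?_⟩ <;>
  · refine ENNReal.tsum_le_tsum fun n => ?_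
    rw [← ENNReal.rpow_natCast, ← ENNReal.rpow_mul]
    refine ENNReal.rpow_le_rpow_of_exponent_le one_le_two ?_
    refine mul_le_mul_of_nonpos_left ?_ (by linarith)
    push_cast
    first
    | exact le_abs_self _
    | exact (by linarith : (n : ℝ) ≤ -(-((n : ℝ) + 1))).trans (neg_le_abs _)

lemma ENNReal.tsum_nat_two_rpow_neg_mul_abs_sub_le (δ : ℝ) (k : ℕ) :
    ∑' n : ℕ, (2 : ℝ≥0∞) ^ (-δ * |(n : ℝ) - k|) ≤
      ∑' z : ℤ, (2 : ℝ≥0∞) ^ (-δ * |(z : ℝ)|) := by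
  have hinj : Function.Injective fun n : ℕ => (n : ℤ) - k := fun m n h => by
    simpa using h
  simpa using ENNReal.tsum_comp_le_tsum_of_injective hinj
    fun z : ℤ => (2 : ℝ≥0∞) ^ (-δ * |(z : ℝ)|)

/-- Off-diagonal decay of a single entry: for `ε ≤ min s (min μ (2 * ν)) / 2`, `β k n` is
bounded, up to a constant, by `2 ^ (-ε * |n - k|)` times the weighted sum of `α`. -/
lemma le_two_rpow_mul_tsum {s μ ν ε : ℝ} (hε : 0 < ε) (hs : 2 * ε ≤ s) (hμ : 2 * ε ≤ μ)
    (hν : ε ≤ ν) {A : ℝ≥0∞} {α : ℕ → ℝ≥0∞} {β : ℕ → ℕ → ℝ≥0∞}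
    (h₁ : ∀ k n : ℕ, β k n ≤ A * ((2 : ℝ≥0∞) ^ k / (2 : ℝ≥0∞) ^ n) ^ (2 * s) * α n)
    (h₂ : ∀ k n : ℕ, n + 2 ≤ k →
      β k n ≤ A * ((2 : ℝ≥0∞) ^ n / (2 : ℝ≥0∞) ^ k) ^ (2 * μ) *
        ∑ l ∈ Finset.range (n + 1), ((2 : ℝ≥0∞) ^ l / (2 : ℝ≥0∞) ^ n) ^ (2 * ν) * α l)
    (k n : ℕ) :
    β k n ≤ (2 : ℝ≥0∞) ^ (2 * s + 2 * ε) * A *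
      (∑' m : ℕ, (2 : ℝ≥0∞) ^ (-ε * |(m : ℝ) - k|) * α m) *
        (2 : ℝ≥0∞) ^ (-ε * |(n : ℝ) - k|) := by
  have hadd : ∀ x y : ℝ, (2 : ℝ≥0∞) ^ x * (2 : ℝ≥0∞) ^ y = (2 : ℝ≥0∞) ^ (x + y) := fun x y =>
    (ENNReal.rpow_add x y two_ne_zero ENNReal.ofNat_ne_top).symm
  rcases le_or_gt (n + 2) k with h | h
  · refine (h₂ k n h).trans ?_
    have hnk : (n : ℝ) + 2 ≤ k := by exact_mod_cast h
    have hterm : ∀ l ∈ Finset.range (n + 1),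
        (2 : ℝ≥0∞) ^ (((n : ℝ) - k) * (2 * μ)) *
          ((2 : ℝ≥0∞) ^ (((l : ℝ) - n) * (2 * ν)) * α l) ≤
        (2 : ℝ≥0∞) ^ (-ε * |(n : ℝ) - k|) * ((2 : ℝ≥0∞) ^ (-ε * |(l : ℝ) - k|) * α l) := by
      intro l hl
      have hln : (l : ℝ) ≤ n := by exact_mod_cast Nat.lt_succ_iff.mp (Finset.mem_range.mp hl)
      rw [← mul_assoc (_ : ℝ≥0∞), ← mul_assoc (_ : ℝ≥0∞), hadd, hadd]
      refine mul_le_mul_left (ENNReal.rpow_le_rpow_of_exponent_le one_le_two ?_) _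
      rw [abs_of_nonpos (by linarith), abs_of_nonpos (by linarith)]
      nlinarith [mul_nonneg (sub_nonneg.mpr hμ) (by linarith : (0 : ℝ) ≤ k - n),
        mul_nonneg (sub_nonneg.mpr hν) (sub_nonneg.mpr hln),
        mul_nonneg hε.le (by linarith : (0 : ℝ) ≤ k - n),
        mul_nonneg hε.le (sub_nonneg.mpr hln)]
    have hD : (1 : ℝ≥0∞) ≤ (2 : ℝ≥0∞) ^ (2 * s + 2 * ε) :=
      ENNReal.one_le_rpow one_le_two (by linarith)
    simp only [ENNReal.two_pow_div_two_pow, ← ENNReal.rpow_mul]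
    rw [mul_assoc, Finset.mul_sum]
    calc _ ≤ A * ∑ l ∈ Finset.range (n + 1), (2 : ℝ≥0∞) ^ (-ε * |(n : ℝ) - k|) *
            ((2 : ℝ≥0∞) ^ (-ε * |(l : ℝ) - k|) * α l) := by
          exact mul_le_mul_right (Finset.sum_le_sum hterm) A
      _ ≤ 1 * A * (∑' m : ℕ, (2 : ℝ≥0∞) ^ (-ε * |(m : ℝ) - k|) * α m) *
            (2 : ℝ≥0∞) ^ (-ε * |(n : ℝ) - k|) := by
          rw [← Finset.mul_sum, one_mul, mul_assoc, mul_comm (tsum _)]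
          gcongr
          exact ENNReal.sum_le_tsum _
      _ ≤ _ := by gcongr
  · refine (h₁ k n).trans ?_
    have hnk : (k : ℝ) ≤ n + 1 := by exact_mod_cast Nat.lt_succ_iff.mp h
    rw [ENNReal.two_pow_div_two_pow, ← ENNReal.rpow_mul]
    calc _ ≤ A * (2 : ℝ≥0∞) ^ (2 * s + 2 * ε + -ε * |(n : ℝ) - k| + -ε * |(n : ℝ) - k|) *
            α n := by
          gcongr
          · exact one_le_two
          · rcases le_total (k : ℝ) n with hkn | hkn
            · rw [abs_of_nonneg (sub_nonneg.mpr hkn)]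
              nlinarith [mul_nonneg (by linarith : (0 : ℝ) ≤ s - ε) (sub_nonneg.mpr hkn)]
            · rw [abs_of_nonpos (sub_nonpos.mpr hkn)]
              nlinarith [mul_nonneg (by linarith : (0 : ℝ) ≤ s + ε)
                (by linarith : (0 : ℝ) ≤ 1 - (k - n))]
      _ = (2 : ℝ≥0∞) ^ (2 * s + 2 * ε) * A * ((2 : ℝ≥0∞) ^ (-ε * |(n : ℝ) - k|) * α n) *
            (2 : ℝ≥0∞) ^ (-ε * |(n : ℝ) - k|) := by
          rw [← hadd, ← hadd]
          ring
      _ ≤ _ := by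
          gcongr
          exact ENNReal.le_tsum (f := fun m : ℕ => (2 : ℝ≥0∞) ^ (-ε * |(m : ℝ) - k|) * α m) n

theorem stmt_8 (s μ ν : ℝ) (hs : 0 < s) (hμ : 0 < μ) (hν : 0 < ν) :
    ∃ C > (0 : ℝ), ∀ A : ℝ, 0 ≤ A → ∀ (α : ℕ → ℝ≥0∞) (β : ℕ → ℕ → ℝ≥0∞),
      (∀ k n : ℕ, β k n ≤
        ENNReal.ofReal A * ((2 : ℝ≥0∞) ^ k / (2 : ℝ≥0∞) ^ n) ^ (2 * s) * α n) →
      (∀ k n : ℕ, n + 2 ≤ k →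
        β k n ≤ ENNReal.ofReal A * ((2 : ℝ≥0∞) ^ n / (2 : ℝ≥0∞) ^ k) ^ (2 * μ) *
          ∑ l ∈ Finset.range (n + 1),
            ((2 : ℝ≥0∞) ^ l / (2 : ℝ≥0∞) ^ n) ^ (2 * ν) * α l) →
      ∀ k : ℕ,
        (∑' n : ℕ, β k n ^ ((1 : ℝ) / 2)) ^ 2 ≤
          ENNReal.ofReal C * ENNReal.ofReal A *
            ∑' n : ℕ,
              (max ((2 : ℝ≥0∞) ^ n / (2 : ℝ≥0∞) ^ k)
                  ((2 : ℝ≥0∞) ^ k / (2 : ℝ≥0∞) ^ n)) ^ (-(min s (min μ (2 * ν)) / 2)) *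
                α n := by
  set ε := min s (min μ (2 * ν)) / 2 with hε_def
  have hε : 0 < ε := by positivity
  have hs' : 2 * ε ≤ s := by
    linarith [min_le_left s (min μ (2 * ν))]
  have hμ' : 2 * ε ≤ μ := by
    linarith [(min_le_right s (min μ (2 * ν))).trans (min_le_left _ _)]
  have hν' : ε ≤ ν := by
    linarith [(min_le_right s (min μ (2 * ν))).trans (min_le_right _ _)]
  set G : ℝ≥0∞ := ∑' z : ℤ, (2 : ℝ≥0∞) ^ (-(ε / 2) * |(z : ℝ)|)
  have hG : G ≠ ∞ := ENNReal.tsum_int_two_rpow_neg_mul_abs_ne_top (half_pos hε)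
  set D : ℝ≥0∞ := (2 : ℝ≥0∞) ^ (2 * s + 2 * ε)
  have hD : D ≠ ∞ := ENNReal.rpow_ne_top_of_nonneg (by positivity) ENNReal.ofNat_ne_top
  refine ⟨(D * G ^ 2).toReal + 1, by positivity, fun A _ α β h₁ h₂ k => ?_⟩
  have hweight : ∀ n : ℕ, (max ((2 : ℝ≥0∞) ^ n / (2 : ℝ≥0∞) ^ k)
      ((2 : ℝ≥0∞) ^ k / (2 : ℝ≥0∞) ^ n)) ^ (-ε) = (2 : ℝ≥0∞) ^ (-ε * |(n : ℝ) - k|) := fun n => by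
    rw [ENNReal.max_two_pow_div_two_pow, ← ENNReal.rpow_mul, mul_comm]
  simp only [hweight]
  set S : ℝ≥0∞ := ∑' m : ℕ, (2 : ℝ≥0∞) ^ (-ε * |(m : ℝ) - k|) * α m
  have hsqrt : ∀ n : ℕ, β k n ^ ((1 : ℝ) / 2) ≤ (D * ENNReal.ofReal A * S) ^ ((1 : ℝ) / 2) *
      (2 : ℝ≥0∞) ^ (-(ε / 2) * |(n : ℝ) - k|) := fun n => by
    refine (ENNReal.rpow_le_rpow (le_two_rpow_mul_tsum hε hs' hμ' hν' h₁ h₂ k n)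
      (by norm_num)).trans_eq ?_
    rw [ENNReal.mul_rpow_of_nonneg _ _ (by norm_num), ← ENNReal.rpow_mul]
    congr 2
    ring
  have hsq : ((D * ENNReal.ofReal A * S) ^ ((1 : ℝ) / 2)) ^ 2 = D * ENNReal.ofReal A * S := by
    rw [← ENNReal.rpow_natCast, ← ENNReal.rpow_mul]
    norm_num
  calc (∑' n : ℕ, β k n ^ ((1 : ℝ) / 2)) ^ 2
      ≤ ((D * ENNReal.ofReal A * S) ^ ((1 : ℝ) / 2) * G) ^ 2 := by
        gcongr
        refine (ENNReal.tsum_le_tsum hsqrt).trans ?_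
        rw [ENNReal.tsum_mul_left]
        gcongr
        exact ENNReal.tsum_nat_two_rpow_neg_mul_abs_sub_le _ k
    _ = D * G ^ 2 * ENNReal.ofReal A * S := by
        rw [mul_pow, hsq]
        ring
    _ ≤ ENNReal.ofReal ((D * G ^ 2).toReal + 1) * ENNReal.ofReal A * S := by
        gcongr
        refine (ENNReal.ofReal_toReal (by finiteness)).symm.le.trans ?_
        exact ENNReal.ofReal_le_ofReal (by linarith)
end

section
/- For every T > 0 there exist c > 0 and N₀ ∈ ℕ such that for every integer N ≥ N₀, the one-dimensional Lebesgue measure of the union ⋃_{(l,m) ∈ 𝒜_N(T)} ( l/m − 1/(mN), l/m + 1/(mN) ) is at least c. -/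
open MeasureTheory

/-- `𝒜_N(T)`: the set of pairs `(l, m)` of positive integers with `gcd(l,m) = 1`,
`N/10 ≤ m ≤ N`, and `0 < l < T·m`. -/
def coprimePairs (T : ℝ) (N : ℕ) : Set (ℕ × ℕ) :=
  {lm : ℕ × ℕ | 0 < lm.1 ∧ 0 < lm.2 ∧ Nat.gcd lm.1 lm.2 = 1 ∧
    (N : ℝ) / 10 ≤ (lm.2 : ℝ) ∧ (lm.2 : ℝ) ≤ (N : ℝ) ∧ (lm.1 : ℝ) < T * (lm.2 : ℝ)}

/-- The interval of radius `1 / (mN)` around `l / m`. -/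
def fareyInterval (N l m : ℕ) : Set ℝ :=
  Set.Ioo ((l : ℝ) / (m : ℝ) - 1 / ((m : ℝ) * (N : ℝ)))
          ((l : ℝ) / (m : ℝ) + 1 / ((m : ℝ) * (N : ℝ)))

/-- Dirichlet's approximation theorem: a point of `(T/4, 3T/4)` lies in `fareyInterval N l m` for
some reduced fraction `l / m` in `(0, T)` with denominator at most `N`. -/
theorem exists_coprime_mem_fareyInterval {T x : ℝ} {N : ℕ} (hN : 0 < N) (hNT : 4 ≤ T * N)
    (hx : x ∈ Set.Ioo (T / 4) (3 * T / 4)) :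
    ∃ l m : ℕ, 0 < l ∧ 0 < m ∧ Nat.gcd l m = 1 ∧ m ≤ N ∧ (l : ℝ) < T * m ∧
      x ∈ fareyInterval N l m := by
  obtain ⟨q, hq, hqN⟩ := Real.exists_rat_abs_sub_le_and_den_le x hN
  have hN' : (0 : ℝ) < N := by exact_mod_cast hN
  have hm : (0 : ℝ) < q.den := by exact_mod_cast q.den_pos
  have hm1 : (1 : ℝ) ≤ q.den := by exact_mod_cast q.den_pos
  have hlt : |x - q| < 1 / ((q.den : ℝ) * N) := by
    refine hq.trans_lt (one_div_lt_one_div_of_lt (by positivity) ?_)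
    nlinarith
  have hsmall : 1 / ((q.den : ℝ) * N) ≤ T / 4 := by
    rw [div_le_div_iff₀ (by positivity) (by norm_num)]
    nlinarith
  obtain ⟨h1, h2⟩ := abs_lt.mp hlt
  obtain ⟨hx1, hx2⟩ := hx
  have hq0 : (0 : ℝ) < q := by linarith
  have hqT : (q : ℝ) < T := by linarith
  have hnum : 0 < q.num := Rat.num_pos.mpr (by exact_mod_cast hq0)
  have hl : ((q.num.natAbs : ℕ) : ℝ) = q.num := by
    rw [Nat.cast_natAbs, abs_of_pos hnum]
  have hqe : (q : ℝ) = (q.num.natAbs : ℝ) / q.den := by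
    rw [hl, ← Rat.cast_def]
  refine ⟨q.num.natAbs, q.den, Int.natAbs_pos.mpr hnum.ne', q.den_pos, q.reduced, hqN, ?_, ?_⟩
  · rwa [hqe, div_lt_iff₀ hm] at hqT
  · rw [hqe] at h1 h2
    exact ⟨by linarith, by linarith⟩

/-- The intervals around fractions of `(0, T)` with denominator at most `N / 10` have total
measure at most `T / 5`. -/
theorem volume_iUnion_fareyInterval_le {T : ℝ} (hT : 0 < T) {N : ℕ} (hN : 0 < N) :
    volume (⋃ m ∈ Finset.Icc 1 (N / 10), ⋃ l ∈ Finset.Icc 1 ⌊T * m⌋₊, fareyInterval N l m) ≤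
      ENNReal.ofReal (T / 5) := by
  have hN' : (0 : ℝ) < N := by exact_mod_cast hN
  have hden (m : ℕ) (hm : m ∈ Finset.Icc 1 (N / 10)) :
      volume (⋃ l ∈ Finset.Icc 1 ⌊T * m⌋₊, fareyInterval N l m) ≤ ENNReal.ofReal (2 * T / N) := by
    have hm0 : (0 : ℝ) < m := by exact_mod_cast (Finset.mem_Icc.mp hm).1
    have hfl : (⌊T * m⌋₊ : ℝ) ≤ T * m := Nat.floor_le (by positivity)
    calc volume (⋃ l ∈ Finset.Icc 1 ⌊T * m⌋₊, fareyInterval N l m)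
        ≤ ∑ l ∈ Finset.Icc 1 ⌊T * m⌋₊, volume (fareyInterval N l m) :=
          measure_biUnion_finset_le _ _
      _ = ∑ _l ∈ Finset.Icc 1 ⌊T * m⌋₊, ENNReal.ofReal (2 / (m * N)) := by
          refine Finset.sum_congr rfl fun l _ => ?_
          rw [fareyInterval, Real.volume_Ioo]
          congr 1
          ring
      _ = ENNReal.ofReal (⌊T * m⌋₊ * (2 / (m * N))) := by
          rw [Finset.sum_const, Nat.card_Icc, Nat.add_sub_cancel, nsmul_eq_mul,
            ENNReal.ofReal_mul (Nat.cast_nonneg _), ENNReal.ofReal_natCast]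
      _ ≤ ENNReal.ofReal (2 * T / N) := by
          refine ENNReal.ofReal_le_ofReal ?_
          calc (⌊T * m⌋₊ : ℝ) * (2 / (m * N)) ≤ T * m * (2 / (m * N)) := by gcongr
            _ = 2 * T / N := by field_simp
  have hdiv : ((N / 10 : ℕ) : ℝ) ≤ N / 10 := by exact_mod_cast Nat.cast_div_le (α := ℝ)
  calc _ ≤ ∑ m ∈ Finset.Icc 1 (N / 10),
          volume (⋃ l ∈ Finset.Icc 1 ⌊T * m⌋₊, fareyInterval N l m) :=
        measure_biUnion_finset_le _ _
    _ ≤ ∑ _m ∈ Finset.Icc 1 (N / 10), ENNReal.ofReal (2 * T / N) := Finset.sum_le_sum hden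
    _ = ENNReal.ofReal ((N / 10 : ℕ) * (2 * T / N)) := by
        rw [Finset.sum_const, Nat.card_Icc, Nat.add_sub_cancel, nsmul_eq_mul,
          ENNReal.ofReal_mul (Nat.cast_nonneg _), ENNReal.ofReal_natCast]
    _ ≤ ENNReal.ofReal (T / 5) := by
        refine ENNReal.ofReal_le_ofReal ?_
        calc ((N / 10 : ℕ) : ℝ) * (2 * T / N) ≤ N / 10 * (2 * T / N) := by gcongr
          _ = T / 5 := by field_simp; norm_num

theorem stmt_12 (T : ℝ) (hT : 0 < T) :
    ∃ c > (0 : ℝ), ∃ N₀ : ℕ, ∀ N : ℕ, N₀ ≤ N →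
      ENNReal.ofReal c ≤
        volume (⋃ lm ∈ coprimePairs T N,
          Set.Ioo ((lm.1 : ℝ) / (lm.2 : ℝ) - 1 / ((lm.2 : ℝ) * (N : ℝ)))
                  ((lm.1 : ℝ) / (lm.2 : ℝ) + 1 / ((lm.2 : ℝ) * (N : ℝ)))) := by
  refine ⟨3 * T / 10, by positivity, max 1 ⌈4 / T⌉₊, fun N hN => ?_⟩
  have hN0 : 0 < N := (le_max_left _ _).trans hN
  have hNT : 4 ≤ T * N := by
    have h := (Nat.le_ceil (4 / T)).trans (Nat.cast_le.mpr ((le_max_right _ _).trans hN))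
    rwa [div_le_iff₀' hT] at h
  change _ ≤ volume (⋃ lm ∈ coprimePairs T N, fareyInterval N lm.1 lm.2)
  set U := ⋃ lm ∈ coprimePairs T N, fareyInterval N lm.1 lm.2
  have hcover : Set.Ioo (T / 4) (3 * T / 4) ⊆
      U ∪ ⋃ m ∈ Finset.Icc 1 (N / 10), ⋃ l ∈ Finset.Icc 1 ⌊T * m⌋₊, fareyInterval N l m := by
    intro x hx
    obtain ⟨l, m, hl, hm, hlm, hmN, hlT, hxI⟩ := exists_coprime_mem_fareyInterval hN0 hNT hx
    by_cases hbig : (N : ℝ) / 10 ≤ m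
    · exact Or.inl (Set.mem_biUnion
        (show (l, m) ∈ coprimePairs T N from ⟨hl, hm, hlm, hbig, by exact_mod_cast hmN, hlT⟩) hxI)
    · have hm10 : m ≤ N / 10 := by
        rw [Nat.le_div_iff_mul_le (by norm_num)]
        rw [not_le, lt_div_iff₀ (by norm_num)] at hbig
        exact_mod_cast hbig.le
      exact Or.inr (Set.mem_biUnion (Finset.mem_Icc.mpr ⟨hm, hm10⟩)
        (Set.mem_biUnion (Finset.mem_Icc.mpr ⟨hl, Nat.le_floor hlT.le⟩) hxI))
  have hvol : ENNReal.ofReal (T / 2) ≤ volume U + ENNReal.ofReal (T / 5) :=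
    calc ENNReal.ofReal (T / 2) = volume (Set.Ioo (T / 4) (3 * T / 4)) := by
          rw [Real.volume_Ioo]
          congr 1
          ring
      _ ≤ _ := (measure_mono hcover).trans (measure_union_le _ _)
      _ ≤ _ := by gcongr; exact volume_iUnion_fareyInterval_le hT hN0
  calc ENNReal.ofReal (3 * T / 10) = ENNReal.ofReal (T / 2) - ENNReal.ofReal (T / 5) := by
        rw [← ENNReal.ofReal_sub _ (by positivity)]
        congr 1
        ring
    _ ≤ volume U := tsub_le_iff_right.mpr hvol
end

section
/- For every dimension d ≥ 1 there exists a constant C = C(d) such that for every integer N ≥ 1 and every nonzero lattice vector k ∈ ℤ^d: Σ_{ξ ∈ ({−N, …, N})^d} (1 + N·|⟨k, ξ⟩|)^{−1/4} ≤ C · N^{d−1} · ( 1 + ‖k‖_∞^{−1/4} · N^{1/2} ), where the sum ranges over all integer vectors ξ with each coordinate in [−N, N]. -/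
theorem sum_Icc_rpow_neg_quarter_le (N : ℕ) :
    ∑ j ∈ Finset.Icc 1 N, (j : ℝ) ^ (-(1 / 4) : ℝ) ≤ 4 / 3 * (N : ℝ) ^ (3 / 4 : ℝ) := by
  induction N with
  | zero => simp
  | succ n ih =>
    rw [Finset.sum_Icc_succ_top (by omega)]
    have hpos : (0 : ℝ) < ((n + 1 : ℕ) : ℝ) := by positivity
    set x : ℝ := ((n + 1 : ℕ) : ℝ) with hx
    have hx1 : 1 ≤ x := by rw [hx]; push_cast; linarith [Nat.cast_nonneg (α := ℝ) n]
    have hn : (n : ℝ) = x * (1 + -(1 / x)) := by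
      rw [hx]; field_simp; push_cast; ring
    have hinv : 1 / x ≤ 1 := by rw [div_le_one hpos]; exact hx1
    have bernoulli : (1 + -(1 / x)) ^ (3 / 4 : ℝ) ≤ 1 + 3 / 4 * -(1 / x) :=
      rpow_one_add_le_one_add_mul_self (by linarith) (by norm_num) (by norm_num)
    have hsplit : x ^ (-(1 / 4) : ℝ) = x ^ (3 / 4 : ℝ) * (1 / x) := by
      rw [show (-(1 / 4) : ℝ) = 3 / 4 - 1 by norm_num, Real.rpow_sub_one hpos.ne']
      ring
    have hstep : (n : ℝ) ^ (3 / 4 : ℝ) ≤ x ^ (3 / 4 : ℝ) * (1 + 3 / 4 * -(1 / x)) := by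
      rw [hn, Real.mul_rpow hpos.le (by linarith)]
      gcongr
    rw [hsplit]
    linarith

theorem sum_ite_add_eq_le_one (s : Finset ℤ) (q a : ℤ) :
    ∑ n ∈ s, (if n + q = a then (1 : ℝ) else 0) ≤ 1 := by
  have h : ∀ n, (n + q = a) ↔ (n = a - q) := fun n => by omega
  simp only [h, Finset.sum_ite_eq']
  split_ifs <;> norm_num

/-- The sum of `(1 + N|c + kn|)^(-1/4)` is dominated termwise by indicator functions of the
distance from `n` to the point where `c + kn` changes sign. -/
theorem one_add_mul_abs_rpow_le {N : ℕ} (hN : 1 ≤ N) {k : ℤ} (hk : k ≠ 0) (c n : ℤ) :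
    (1 + (N : ℝ) * |(c : ℝ) + k * n|) ^ (-(1 / 4) : ℝ) ≤
      (∑ a ∈ Finset.Icc (-1 : ℤ) 1, if n + c / k = a then (1 : ℝ) else 0) +
      ((N : ℝ) * k.natAbs) ^ (-(1 / 4) : ℝ) * ((N : ℝ) ^ (-(1 / 4) : ℝ) +
        ∑ j ∈ Finset.Icc 1 N, ((if n + c / k = (j : ℤ) + 1 then (1 : ℝ) else 0) +
          (if n + c / k = -((j : ℤ) + 1) then (1 : ℝ) else 0)) * (j : ℝ) ^ (-(1 / 4) : ℝ)) := by
  set m := n + c / k with hm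
  have hNpos : (0 : ℝ) < N := by exact_mod_cast hN
  have hKpos : (0 : ℝ) < k.natAbs := by exact_mod_cast Int.natAbs_pos.mpr hk
  have lower : (k.natAbs : ℝ) * (|m| - 1 : ℤ) ≤ |(c : ℝ) + k * n| := by
    have h : |k| * (|m| - 1) ≤ |c + k * n| := by
      have h1 : c + k * n = k * m + c % k := by
        rw [hm, mul_add, add_assoc, Int.mul_ediv_add_emod, add_comm]
      have h2 := Int.emod_nonneg c hk
      have h3 := Int.emod_lt_abs c hk
      have h4 := abs_sub_abs_le_abs_sub (k * m) (-(c % k))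
      rw [abs_neg, abs_of_nonneg h2, abs_mul, sub_neg_eq_add, ← h1] at h4
      linarith
    rw [Nat.cast_natAbs]
    exact_mod_cast h
  have tail : ∀ j : ℕ, 1 ≤ j → (j : ℤ) ≤ |m| - 1 →
      (1 + (N : ℝ) * |(c : ℝ) + k * n|) ^ (-(1 / 4) : ℝ) ≤
        ((N : ℝ) * k.natAbs) ^ (-(1 / 4) : ℝ) * (j : ℝ) ^ (-(1 / 4) : ℝ) := by
    intro j hj hjm
    have hjpos : (0 : ℝ) < j := by exact_mod_cast hj
    rw [← Real.mul_rpow (by positivity) hjpos.le]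
    apply Real.rpow_le_rpow_of_nonpos (by positivity) _ (by norm_num)
    have hjm' : (j : ℝ) ≤ ((|m| - 1 : ℤ) : ℝ) := by exact_mod_cast hjm
    have : (k.natAbs : ℝ) * j ≤ |(c : ℝ) + k * n| :=
      (mul_le_mul_of_nonneg_left hjm' hKpos.le).trans lower
    have := mul_le_mul_of_nonneg_left this hNpos.le
    linarith
  have ind : ∀ a : ℤ, (0 : ℝ) ≤ if m = a then (1 : ℝ) else 0 := fun a => by
    split_ifs <;> norm_num
  have hnear : (0 : ℝ) ≤ ∑ a ∈ Finset.Icc (-1 : ℤ) 1, if m = a then (1 : ℝ) else 0 :=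
    Finset.sum_nonneg fun a _ => ind a
  have hterm : ∀ j ∈ Finset.Icc 1 N, (0 : ℝ) ≤ ((if m = (j : ℤ) + 1 then (1 : ℝ) else 0) +
      (if m = -((j : ℤ) + 1) then (1 : ℝ) else 0)) * (j : ℝ) ^ (-(1 / 4) : ℝ) := fun j _ =>
    mul_nonneg (add_nonneg (ind _) (ind _)) (by positivity)
  have hfar := Finset.sum_nonneg hterm
  have hM : (0 : ℝ) ≤ ((N : ℝ) * k.natAbs) ^ (-(1 / 4) : ℝ) := by positivity
  have hN4 : (0 : ℝ) ≤ (N : ℝ) ^ (-(1 / 4) : ℝ) := by positivity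
  rcases le_or_gt |m| 1 with h | h
  · have hmem : m ∈ Finset.Icc (-1 : ℤ) 1 := Finset.mem_Icc.mpr (abs_le.mp h)
    rw [Finset.sum_ite_eq, if_pos hmem]
    have h1 : (1 + (N : ℝ) * |(c : ℝ) + k * n|) ^ (-(1 / 4) : ℝ) ≤ 1 :=
      Real.rpow_le_one_of_one_le_of_nonpos (le_add_of_nonneg_right (by positivity)) (by norm_num)
    linarith [mul_nonneg hM (add_nonneg hN4 hfar)]
  · refine le_add_of_nonneg_of_le hnear ?_
    rcases le_or_gt ((N : ℤ) + 1) |m| with h' | h'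
    · refine (tail N hN (by omega)).trans (mul_le_mul_of_nonneg_left ?_ hM)
      linarith
    · obtain ⟨j, hj⟩ : ∃ j : ℕ, (j : ℤ) = |m| - 1 := ⟨(|m| - 1).toNat, by omega⟩
      refine (tail j (by omega) hj.le).trans (mul_le_mul_of_nonneg_left ?_ hM)
      refine le_add_of_nonneg_of_le hN4 (le_trans ?_ (Finset.single_le_sum hterm
        (Finset.mem_Icc.mpr (show 1 ≤ j ∧ j ≤ N by omega))))
      refine le_mul_of_one_le_left (by positivity) ?_
      rcases abs_choice m with hm' | hm'
      · rw [if_pos (show m = (j : ℤ) + 1 by omega)]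
        linarith [ind (-((j : ℤ) + 1))]
      · rw [if_pos (show m = -((j : ℤ) + 1) by omega)]
        linarith [ind ((j : ℤ) + 1)]

theorem sum_Icc_one_add_mul_abs_rpow_le {N : ℕ} (hN : 1 ≤ N) {k : ℤ} (hk : k ≠ 0) (c : ℤ) :
    ∑ n ∈ Finset.Icc (-(N : ℤ)) N, (1 + (N : ℝ) * |(c : ℝ) + k * n|) ^ (-(1 / 4) : ℝ) ≤
      6 * (1 + (k.natAbs : ℝ) ^ (-(1 / 4) : ℝ) * (N : ℝ) ^ ((1 : ℝ) / 2)) := by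
  have hNpos : (0 : ℝ) < N := by exact_mod_cast hN
  have hN1 : (1 : ℝ) ≤ N := by exact_mod_cast hN
  refine (Finset.sum_le_sum fun n _ => one_add_mul_abs_rpow_le hN hk c n).trans ?_
  rw [Finset.sum_add_distrib, ← Finset.mul_sum, Finset.sum_add_distrib, Finset.sum_comm,
    Finset.sum_comm (s := Finset.Icc (-(N : ℤ)) N) (t := Finset.Icc 1 N), Finset.sum_const,
    Int.card_Icc]
  have near : ∑ a ∈ Finset.Icc (-1 : ℤ) 1, ∑ n ∈ Finset.Icc (-(N : ℤ)) N,
      (if n + c / k = a then (1 : ℝ) else 0) ≤ 3 := by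
    refine (Finset.sum_le_sum fun a _ => sum_ite_add_eq_le_one _ _ a).trans ?_
    simp
  have middle : ∑ j ∈ Finset.Icc 1 N, ∑ n ∈ Finset.Icc (-(N : ℤ)) N,
      ((if n + c / k = (j : ℤ) + 1 then (1 : ℝ) else 0) +
        (if n + c / k = -((j : ℤ) + 1) then (1 : ℝ) else 0)) * (j : ℝ) ^ (-(1 / 4) : ℝ) ≤
      2 * (4 / 3 * (N : ℝ) ^ (3 / 4 : ℝ)) := by
    refine le_trans ?_ (mul_le_mul_of_nonneg_left (sum_Icc_rpow_neg_quarter_le N) zero_le_two)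
    rw [Finset.mul_sum]
    refine Finset.sum_le_sum fun j _ => ?_
    rw [← Finset.sum_mul, Finset.sum_add_distrib]
    refine mul_le_mul_of_nonneg_right ?_ (by positivity)
    linarith [sum_ite_add_eq_le_one (Finset.Icc (-(N : ℤ)) N) (c / k) ((j : ℤ) + 1),
      sum_ite_add_eq_le_one (Finset.Icc (-(N : ℤ)) N) (c / k) (-((j : ℤ) + 1))]
  have far : ((N : ℤ) + 1 - -(N : ℤ)).toNat • (N : ℝ) ^ (-(1 / 4) : ℝ) ≤
      3 * (N : ℝ) ^ (3 / 4 : ℝ) := by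
    rw [show ((N : ℤ) + 1 - -(N : ℤ)).toNat = 2 * N + 1 by omega, nsmul_eq_mul,
      show (3 / 4 : ℝ) = -(1 / 4) + 1 by norm_num, Real.rpow_add_one hNpos.ne']
    push_cast
    nlinarith [Real.rpow_nonneg hNpos.le (-(1 / 4) : ℝ)]
  have scale : ((N : ℝ) * k.natAbs) ^ (-(1 / 4) : ℝ) * (N : ℝ) ^ (3 / 4 : ℝ) =
      (k.natAbs : ℝ) ^ (-(1 / 4) : ℝ) * (N : ℝ) ^ ((1 : ℝ) / 2) := by
    rw [Real.mul_rpow hNpos.le (by positivity), mul_right_comm, ← Real.rpow_add hNpos, mul_comm]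
    norm_num
  have hM : (0 : ℝ) ≤ ((N : ℝ) * k.natAbs) ^ (-(1 / 4) : ℝ) := by positivity
  have hP : (0 : ℝ) ≤ (N : ℝ) ^ (3 / 4 : ℝ) := by positivity
  refine (add_le_add near (mul_le_mul_of_nonneg_left (add_le_add far middle) hM)).trans ?_
  rw [← scale]
  nlinarith [mul_nonneg hM hP]

theorem stmt_13 (d : ℕ) (hd : 1 ≤ d) :
    ∃ C > (0 : ℝ), ∀ N : ℕ, 1 ≤ N → ∀ k : Fin d → ℤ, k ≠ 0 →
      (∑ ξ ∈ Finset.Icc (fun _ => -(N : ℤ)) (fun _ => (N : ℤ)),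
        (1 + (N : ℝ) * |∑ i, (k i : ℝ) * (ξ i : ℝ)|) ^ (-(1 / 4) : ℝ)) ≤
      C * (N : ℝ) ^ (d - 1) *
        (1 + (((Finset.univ.sup fun i => (k i).natAbs) : ℕ) : ℝ) ^ (-(1 / 4) : ℝ) *
          (N : ℝ) ^ ((1 : ℝ) / 2)) := by
  obtain ⟨e, rfl⟩ : ∃ e, d = e + 1 := ⟨d - 1, by omega⟩
  refine ⟨6 * 3 ^ e, by positivity, fun N hN k hk => ?_⟩
  obtain ⟨p, -, hp⟩ := Finset.exists_mem_eq_sup Finset.univ Finset.univ_nonempty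
    fun i => (k i).natAbs
  have hkp : k p ≠ 0 := by
    contrapose! hk
    funext i
    have := Finset.le_sup (f := fun i => (k i).natAbs) (Finset.mem_univ i)
    rw [hp] at this
    simpa [hk] using this
  rw [hp, add_tsub_cancel_right]
  have hN1 : (1 : ℝ) ≤ N := by exact_mod_cast hN
  set B : ℝ := 1 + ((k p).natAbs : ℝ) ^ (-(1 / 4) : ℝ) * (N : ℝ) ^ ((1 : ℝ) / 2) with hB
  have reindex : ∑ ξ ∈ Finset.Icc (fun _ : Fin (e + 1) => -(N : ℤ)) (fun _ => (N : ℤ)),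
      (1 + (N : ℝ) * |∑ i, (k i : ℝ) * (ξ i : ℝ)|) ^ (-(1 / 4) : ℝ) =
      ∑ η ∈ Finset.Icc (fun _ : Fin e => -(N : ℤ)) (fun _ => (N : ℤ)),
        ∑ n ∈ Finset.Icc (-(N : ℤ)) N,
          (1 + (N : ℝ) * |((∑ i, k (p.succAbove i) * η i : ℤ) : ℝ) + k p * n|) ^
            (-(1 / 4) : ℝ) := by
    rw [← Finset.sum_product_right']
    refine (Finset.sum_equiv (Fin.insertNthEquiv (fun _ => ℤ) p) ?_ ?_).symm
    · rintro ⟨n, η⟩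
      rw [Finset.mem_product, Finset.mem_Icc, Finset.mem_Icc, Finset.mem_Icc]
      simp only [Pi.le_def, Fin.forall_iff_succAbove p, Fin.insertNthEquiv_apply,
        Fin.insertNth_apply_same, Fin.insertNth_apply_succAbove]
      tauto
    · rintro ⟨n, η⟩ -
      simp only [Fin.insertNthEquiv_apply, Fin.sum_univ_succAbove _ p, Fin.insertNth_apply_same,
        Fin.insertNth_apply_succAbove]
      push_cast
      rw [add_comm (∑ i, _)]
  rw [reindex]
  refine (Finset.sum_le_sum fun η _ => sum_Icc_one_add_mul_abs_rpow_le hN hkp _).trans ?_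
  rw [← hB, Finset.sum_const, nsmul_eq_mul, Pi.card_Icc]
  simp only [Int.card_Icc, Finset.prod_const, Finset.card_univ, Fintype.card_fin]
  rw [show ((N : ℤ) + 1 - -(N : ℤ)).toNat = 2 * N + 1 by omega]
  have hcard : ((((2 * N + 1) ^ e : ℕ)) : ℝ) ≤ 3 ^ e * (N : ℝ) ^ e := by
    rw [← mul_pow]
    push_cast
    gcongr
    linarith
  have hBnonneg : 0 ≤ 6 * B := by positivity
  calc _ ≤ 3 ^ e * (N : ℝ) ^ e * (6 * B) := mul_le_mul_of_nonneg_right hcard hBnonneg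
    _ = _ := by ring
end
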